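/- arXiv:2404.06754 — 5 statements merged into one kernel-verified Lean document; each statement's English description precedes it below -/
import Mathlib

section
/- There exists a constant C > 0 such that the following holds. Let q be an odd prime power and let M, N be invertible symmetric 3×3 matrices over F_q such that N is not a scalar multiple of M (so the conics {f=0} and {g=0} are distinct and irreducible, where f(v) = vᵀMv and g(v) = vᵀNv). Then the number of nonzero vectors v ∈ F_q³ such that (−det M)·f(v) is a nonzero square in F_q and (−det N)·g(v) is a non-square in F_q satisfies |count − (q−1)·q²/4| ≤ C·(q−1)·q^{3/2}. (Equivalently, the number of points P ∈ P²(F_q) external to the conic {f=0} and internal to the conic {g=0} is q²/4 + O(q^{3/2}).) -/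
open Matrix

section TernaryForms

variable {F : Type*} [Field F]

/-- Evaluating the quadratic form of `M` is linear in `M`. -/
lemma dotProduct_add_smul_mulVec_self (M N : Matrix (Fin 3) (Fin 3) F) (t : F) (v : Fin 3 → F) :
    v ⬝ᵥ (M + t • N) *ᵥ v = v ⬝ᵥ M *ᵥ v + t * (v ⬝ᵥ N *ᵥ v) := by
  simp [add_mulVec, smul_mulVec, dotProduct_add]

/-- A nonzero ternary quadratic form is diagonal in suitable coordinates, with a nonzero last
coefficient. -/
lemma exists_ternary_diagonalization (h2 : (2 : F) ≠ 0) {M : Matrix (Fin 3) (Fin 3) F}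
    (hM : M.IsSymm) (hM0 : M ≠ 0) :
    ∃ (a b c : F) (e : (Fin 3 → F) ≃ F × F × F), c ≠ 0 ∧ (M.det ≠ 0 → a ≠ 0 ∧ b ≠ 0) ∧
      ∀ v, v ⬝ᵥ M *ᵥ v = a * (e v).1 ^ 2 + b * (e v).2.1 ^ 2 + c * (e v).2.2 ^ 2 := by
  have := invertibleOfNonzero h2
  set B : LinearMap.BilinForm F (Fin 3 → F) := Matrix.toLinearMap₂' F M with hB
  have hBsymm : LinearMap.IsSymm B := by
    refine ⟨fun x y ↦ ?_⟩
    simp only [hB, Matrix.toLinearMap₂'_apply', RingHom.id_apply]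
    rw [dotProduct_comm, ← vecMul_transpose, hM.eq, ← dotProduct_mulVec]
  obtain ⟨v₀, hv₀⟩ := LinearMap.BilinForm.exists_orthogonal_basis hBsymm
  have h3 : Module.finrank F (Fin 3 → F) = 3 := by simp
  obtain ⟨v₁, hv₁⟩ : ∃ v : Module.Basis (Fin 3) F (Fin 3 → F), B.IsOrthoᵢ v := by
    refine ⟨v₀.reindex (finCongr h3), fun i j hij ↦ ?_⟩
    simpa [Module.Basis.reindex_apply] using! hv₀ ((finCongr h3).symm.injective.ne hij)
  obtain ⟨i, hi⟩ : ∃ i, B (v₁ i) (v₁ i) ≠ 0 := by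
    by_contra! h
    have hB0 : B = 0 := by
      refine LinearMap.BilinForm.ext_basis v₁ fun i j ↦ ?_
      by_cases hij : i = j
      · simp [hij, h]
      · exact hv₁ hij
    exact hM0 ((Matrix.toLinearMap₂' F).map_eq_zero_iff.mp hB0)
  obtain ⟨v, hv, hv2⟩ : ∃ v : Module.Basis (Fin 3) F (Fin 3 → F),
      B.IsOrthoᵢ v ∧ B (v 2) (v 2) ≠ 0 := by
    refine ⟨v₁.reindex (Equiv.swap i 2), fun j k hjk ↦ ?_, ?_⟩
    · simpa [Module.Basis.reindex_apply] using! hv₁ ((Equiv.swap i 2).injective.ne hjk)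
    · simpa [Module.Basis.reindex_apply] using hi
  let s : (Fin 3 → F) ≃ F × F × F :=
    { toFun := fun x ↦ (x 0, x 1, x 2)
      invFun := fun p ↦ ![p.1, p.2.1, p.2.2]
      left_inv := fun x ↦ by ext i; fin_cases i <;> rfl
      right_inv := fun _ ↦ rfl }
  refine ⟨B (v 0) (v 0), B (v 1) (v 1), B (v 2) (v 2), v.equivFun.toEquiv.trans s, hv2,
    fun hdet ↦ ?_, fun x ↦ ?_⟩
  · have h := hv.not_isOrtho_basis_self_of_separatingLeft
      (LinearMap.separatingLeft_toLinearMap₂'_of_det_ne_zero' hdet)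
    exact ⟨h 0, h 1⟩
  · have hx : x ⬝ᵥ M *ᵥ x = B x x := (Matrix.toLinearMap₂'_apply' M x x).symm
    have hv' : ∀ i j, i ≠ j → B (v i) (v j) = 0 := fun i j hij ↦ hv hij
    have hs : v.equivFun.toEquiv.trans s x =
        (v.equivFun x 0, v.equivFun x 1, v.equivFun x 2) := rfl
    rw [hx, hs]
    generalize hc : v.equivFun x = c
    rw [← v.sum_equivFun x, hc]
    simp [Fin.sum_univ_three, hv']
    ring

variable [Fintype F] [DecidableEq F]

/-- A nondegenerate binary quadratic form takes square and non-square values equally often,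
because it admits a similitude with non-square multiplier. -/
lemma sum_quadraticChar_binary (hF : ringChar F ≠ 2) {a b : F} (ha : a ≠ 0) (hb : b ≠ 0) :
    ∑ x : F, ∑ y : F, quadraticChar F (a * x ^ 2 + b * y ^ 2) = 0 := by
  obtain ⟨d, hd⟩ := quadraticChar_exists_neg_one hF
  have hd0 : d ≠ 0 := by rintro rfl; simp at hd
  obtain ⟨u, w, huw⟩ : ∃ u w : F, a * u ^ 2 + b * w ^ 2 = a * d := by
    obtain ⟨u, w, h⟩ := FiniteField.exists_root_sum_quadratic (R := F)
      (f := Polynomial.C a * Polynomial.X ^ 2 + Polynomial.C 0 * Polynomial.X +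
        Polynomial.C (-(a * d)))
      (g := Polynomial.C b * Polynomial.X ^ 2 + Polynomial.C 0 * Polynomial.X + Polynomial.C 0)
      (Polynomial.degree_quadratic ha) (Polynomial.degree_quadratic hb)
      (FiniteField.odd_card_of_char_ne_two hF)
    refine ⟨u, w, ?_⟩
    simp at h
    linear_combination h
  have hd' : u ^ 2 + b / a * w ^ 2 = d := by field_simp; linear_combination huw
  let e : F × F ≃ F × F :=
    { toFun := fun p ↦ (u * p.1 - b / a * w * p.2, w * p.1 + u * p.2)
      invFun := fun p ↦ ((u * p.1 + b / a * w * p.2) / d, (u * p.2 - w * p.1) / d)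
      left_inv := fun p ↦ by
        ext
        · simp only; rw [div_eq_iff hd0, ← hd']; ring
        · simp only; rw [div_eq_iff hd0, ← hd']; ring
      right_inv := fun p ↦ by
        ext
        · simp only; rw [← mul_right_inj' hd0]
          trans (u ^ 2 + b / a * w ^ 2) * p.1
          · field_simp; ring
          · rw [hd']
        · simp only; rw [← mul_right_inj' hd0]
          trans (u ^ 2 + b / a * w ^ 2) * p.2
          · field_simp; ring
          · rw [hd'] }
  rw [← Fintype.sum_prod_type' (f := fun x y ↦ quadraticChar F (a * x ^ 2 + b * y ^ 2))]
  have key := e.sum_comp fun p : F × F ↦ quadraticChar F (a * p.1 ^ 2 + b * p.2 ^ 2)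
  have hmul (p : F × F) : quadraticChar F (a * (e p).1 ^ 2 + b * (e p).2 ^ 2) =
      -quadraticChar F (a * p.1 ^ 2 + b * p.2 ^ 2) := by
    rw [show a * (e p).1 ^ 2 + b * (e p).2 ^ 2 = d * (a * p.1 ^ 2 + b * p.2 ^ 2) by
      simp only [e, Equiv.coe_fn_mk, ← hd']; field_simp; ring, map_mul, hd, neg_one_mul]
  simp only [hmul, Finset.sum_neg_distrib] at key
  linarith

/-- The number of zeros in `F³` of the quadratic form of a `3 × 3` matrix. -/
def ternaryZeroCount (M : Matrix (Fin 3) (Fin 3) F) : ℤ :=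
  ∑ v : Fin 3 → F, if v ⬝ᵥ M *ᵥ v = 0 then 1 else 0

lemma abs_quadraticChar_le_one (a : F) : |quadraticChar F a| ≤ 1 := by
  rcases quadraticChar_isQuadratic F a with h | h | h <;> simp [h]

/-- The deviation of the number of zeros of a nonzero ternary form from `q²` is at most `q²`, and it
vanishes for nondegenerate forms. -/
lemma ternaryZeroCount_bounds (hF : ringChar F ≠ 2) {M : Matrix (Fin 3) (Fin 3) F}
    (hM : M.IsSymm) (hM0 : M ≠ 0) :
    |ternaryZeroCount M - (Fintype.card F : ℤ) ^ 2| ≤ (Fintype.card F : ℤ) ^ 2 ∧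
      (M.det ≠ 0 → ternaryZeroCount M = (Fintype.card F : ℤ) ^ 2) := by
  obtain ⟨a, b, c, e, hc, hab, hdiag⟩ :=
    exists_ternary_diagonalization (Ring.two_ne_zero hF) hM hM0
  have hroots (x y : F) :
      ∑ z : F, (if a * x ^ 2 + b * y ^ 2 + c * z ^ 2 = 0 then (1 : ℤ) else 0) =
        quadraticChar F (-a / c * x ^ 2 + -b / c * y ^ 2) + 1 := by
    rw [← quadraticChar_card_sqrts hF, Finset.sum_boole]
    congr 2
    ext z
    simp only [Finset.mem_filter, Finset.mem_univ, true_and, Set.mem_toFinset, Set.mem_ofPred_eq]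
    constructor
    · intro h; field_simp; linear_combination h
    · intro h; field_simp at h; linear_combination h
  have hcount : ternaryZeroCount M = (Fintype.card F : ℤ) ^ 2 +
      ∑ x : F, ∑ y : F, quadraticChar F (-a / c * x ^ 2 + -b / c * y ^ 2) := by
    simp only [ternaryZeroCount, hdiag]
    rw [e.sum_comp fun p : F × F × F ↦
      if a * p.1 ^ 2 + b * p.2.1 ^ 2 + c * p.2.2 ^ 2 = 0 then (1 : ℤ) else 0]
    simp only [Fintype.sum_prod_type, hroots, Finset.sum_add_distrib]
    simp
    ring
  constructor
  · rw [hcount, add_sub_cancel_left]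
    calc _ ≤ ∑ x : F, ∑ y : F, |quadraticChar F (-a / c * x ^ 2 + -b / c * y ^ 2)| :=
          (Finset.abs_sum_le_sum_abs _ _).trans
            (Finset.sum_le_sum fun _ _ ↦ Finset.abs_sum_le_sum_abs _ _)
      _ ≤ ∑ x : F, ∑ y : F, 1 := by gcongr; exact abs_quadraticChar_le_one _
      _ = _ := by simp; ring
  · intro hdet
    obtain ⟨ha, hb⟩ := hab hdet
    rw [hcount, sum_quadraticChar_binary hF (div_ne_zero (neg_ne_zero.mpr ha) hc)
      (div_ne_zero (neg_ne_zero.mpr hb) hc), add_zero]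

lemma ternaryZeroCount_le (hF : ringChar F ≠ 2) {M : Matrix (Fin 3) (Fin 3) F}
    (hM : M.IsSymm) (hM0 : M ≠ 0) : ternaryZeroCount M ≤ 2 * (Fintype.card F : ℤ) ^ 2 := by
  linarith [(abs_le.mp (ternaryZeroCount_bounds hF hM hM0).1).2]

lemma sum_quadraticChar_neg (hF : ringChar F ≠ 2) : ∑ t : F, quadraticChar F (-t) = 0 :=
  (Equiv.sum_comp (Equiv.neg F) fun t ↦ quadraticChar F t).trans (quadraticChar_sum_zero hF)

/-- Detect the value `-a / b` by the linear equation `a + t * b = 0` in `t`. -/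
lemma quadraticChar_mul_eq_sum (hF : ringChar F ≠ 2) (a b : F) :
    quadraticChar F (a * b) =
      ∑ t : F, quadraticChar F (-t) * if a + t * b = 0 then 1 else 0 := by
  by_cases hb : b = 0
  · rw [hb, mul_zero, MulChar.map_zero]
    simp only [mul_zero, add_zero, ← Finset.sum_mul, sum_quadraticChar_neg hF, zero_mul]
  · have hiff (t : F) : a + t * b = 0 ↔ t = -(a / b) := by
      rw [← neg_div, eq_div_iff hb, add_comm, add_eq_zero_iff_eq_neg]
    simp only [hiff, mul_ite, mul_one, mul_zero, Finset.sum_ite_eq', Finset.mem_univ, if_true,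
      neg_neg]
    rw [show a * b = a / b * b ^ 2 by field_simp, map_mul, quadraticChar_sq_one' hb, mul_one]

open Polynomial in
/-- A pencil of `3 × 3` matrices containing an invertible one has at most three singular
members. -/
lemma card_singular_pencil_le {M : Matrix (Fin 3) (Fin 3) F} (hM : M.det ≠ 0)
    (N : Matrix (Fin 3) (Fin 3) F) :
    (Finset.univ.filter fun t : F ↦ (M + t • N).det = 0).card ≤ 3 := by
  set p : F[X] := det ((X : F[X]) • N.map C + M.map C) with hp
  have heval (t : F) : p.eval t = (M + t • N).det := by
    rw [hp, ← coe_evalRingHom, RingHom.map_det]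
    congr 1
    ext i j
    simp [add_comm (M i j), mul_comm t]
  have hp0 : p ≠ 0 := by
    intro h
    have := heval 0
    simp [h] at this
    exact hM this.symm
  calc _ ≤ p.roots.toFinset.card := Finset.card_le_card fun t ht ↦ by
        simpa [hp0, heval] using ht
    _ ≤ p.roots.card := Multiset.toFinset_card_le _
    _ ≤ p.natDegree := p.card_roots'
    _ ≤ 3 := by simpa using natDegree_det_X_add_C_le N M

/-- Cancellation in the character sum of a product of two ternary forms. -/
lemma abs_sum_quadraticChar_mul_le (hF : ringChar F ≠ 2) {M N : Matrix (Fin 3) (Fin 3) F}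
    (hM : M.IsSymm) (hN : N.IsSymm) (hdet : M.det ≠ 0) (hMN : ∀ t : F, M + t • N ≠ 0) :
    |∑ v : Fin 3 → F, quadraticChar F ((v ⬝ᵥ M *ᵥ v) * (v ⬝ᵥ N *ᵥ v))| ≤
      3 * (Fintype.card F : ℤ) ^ 2 := by
  have hsymm (t : F) : (M + t • N).IsSymm := hM.add (hN.smul t)
  have hsum : ∑ v : Fin 3 → F, quadraticChar F ((v ⬝ᵥ M *ᵥ v) * (v ⬝ᵥ N *ᵥ v)) =
      ∑ t : F, quadraticChar F (-t) *
        (ternaryZeroCount (M + t • N) - (Fintype.card F : ℤ) ^ 2) := by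
    simp only [quadraticChar_mul_eq_sum hF, mul_sub, Finset.sum_sub_distrib, ← Finset.sum_mul,
      sum_quadraticChar_neg hF, zero_mul, sub_zero]
    rw [Finset.sum_comm]
    simp only [ternaryZeroCount, dotProduct_add_smul_mulVec_self, Finset.mul_sum]
  rw [hsum]
  calc _ ≤ ∑ t : F, |quadraticChar F (-t) *
          (ternaryZeroCount (M + t • N) - (Fintype.card F : ℤ) ^ 2)| :=
        Finset.abs_sum_le_sum_abs _ _
    _ ≤ ∑ t : F, if (M + t • N).det = 0 then (Fintype.card F : ℤ) ^ 2 else 0 := by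
        refine Finset.sum_le_sum fun t _ ↦ ?_
        have hZ := ternaryZeroCount_bounds hF (hsymm t) (hMN t)
        split_ifs with h
        · rw [abs_mul]
          exact (mul_le_of_le_one_left (abs_nonneg _) (abs_quadraticChar_le_one _)).trans hZ.1
        · simp [hZ.2 h]
    _ ≤ 3 * (Fintype.card F : ℤ) ^ 2 := by
        rw [← Finset.sum_filter, Finset.sum_const, nsmul_eq_mul]
        gcongr
        exact_mod_cast card_singular_pencil_le hdet N

lemma abs_sum_quadraticChar_le (hF : ringChar F ≠ 2) {M : Matrix (Fin 3) (Fin 3) F}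
    (hM : M.IsSymm) (hdet : M.det ≠ 0) :
    |∑ v : Fin 3 → F, quadraticChar F (v ⬝ᵥ M *ᵥ v)| ≤ 5 * (Fintype.card F : ℤ) ^ 2 := by
  set E : Matrix (Fin 3) (Fin 3) F := Matrix.diagonal ![0, 0, 1] with hE
  have hEsymm : E.IsSymm := Matrix.isSymm_diagonal _
  have hE0 : E ≠ 0 := fun h ↦ by simpa [hE] using congrFun (congrFun h 2) 2
  have hform (v : Fin 3 → F) : v ⬝ᵥ E *ᵥ v = v 2 ^ 2 := by
    simp [hE, dotProduct, mulVec_diagonal, Fin.sum_univ_three, sq]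
  have hME (t : F) : M + t • E ≠ 0 := by
    intro h
    apply hdet
    rw [eq_neg_of_add_eq_zero_left h, hE, ← neg_smul, det_smul, det_diagonal]
    simp [Fin.prod_univ_three]
  have hprod := abs_sum_quadraticChar_mul_le hF hM hEsymm hdet hME
  have hzero := ternaryZeroCount_le hF hEsymm hE0
  have hdiff : |∑ v : Fin 3 → F, quadraticChar F (v ⬝ᵥ M *ᵥ v) -
      ∑ v : Fin 3 → F, quadraticChar F ((v ⬝ᵥ M *ᵥ v) * (v ⬝ᵥ E *ᵥ v))| ≤
      ternaryZeroCount E := by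
    rw [← Finset.sum_sub_distrib]
    refine (Finset.abs_sum_le_sum_abs _ _).trans (Finset.sum_le_sum fun v _ ↦ ?_)
    rw [hform]
    by_cases hv : v 2 = 0
    · simpa [hv] using abs_quadraticChar_le_one _
    · rw [map_mul, quadraticChar_sq_one' hv]
      simp [hv]
  rw [abs_le] at *
  constructor <;> linarith [hdiff.1, hdiff.2, hprod.1, hprod.2]

/-- Expand the joint indicator of "nonzero square" and "non-square" in quadratic characters. -/
lemma abs_four_mul_indicator_sub_le (a b : F) :
    |4 * (if (IsSquare a ∧ a ≠ 0) ∧ ¬IsSquare b then (1 : ℤ) else 0) -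
        (1 + quadraticChar F a - quadraticChar F b - quadraticChar F (a * b))| ≤
      2 * (if a = 0 then 1 else 0) + 2 * (if b = 0 then 1 else 0) := by
  simp only [← quadraticChar_neg_one_iff_not_isSquare, map_mul]
  by_cases ha : a = 0
  · rcases quadraticChar_isQuadratic F b with h | h | h <;> simp [ha, h] <;> split_ifs <;> simp
  simp only [← quadraticChar_one_iff_isSquare ha]
  by_cases hb : b = 0
  · rcases quadraticChar_dichotomy ha with h | h <;> simp [ha, hb, h]
  · rcases quadraticChar_dichotomy ha with h | h <;>
      rcases quadraticChar_dichotomy hb with h' | h' <;> simp [ha, hb, h, h']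

/-- The joint count for two nonproportional nondegenerate ternary forms is `q³ / 4 + O(q²)`. -/
lemma abs_four_mul_card_sub_le (hF : ringChar F ≠ 2) {M N : Matrix (Fin 3) (Fin 3) F}
    (hM : M.IsSymm) (hN : N.IsSymm) (hMdet : M.det ≠ 0) (hNdet : N.det ≠ 0)
    (hMN : ∀ t : F, M + t • N ≠ 0) :
    |4 * (∑ v : Fin 3 → F, if (IsSquare (v ⬝ᵥ M *ᵥ v) ∧ v ⬝ᵥ M *ᵥ v ≠ 0) ∧
        ¬IsSquare (v ⬝ᵥ N *ᵥ v) then (1 : ℤ) else 0) - (Fintype.card F : ℤ) ^ 3| ≤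
      21 * (Fintype.card F : ℤ) ^ 2 := by
  have hM0 : M ≠ 0 := by simpa using hMN 0
  have hN0 : N ≠ 0 := by rintro rfl; simp at hNdet
  have hZM := (ternaryZeroCount_bounds hF hM hM0).2 hMdet
  have hZN := (ternaryZeroCount_bounds hF hN hN0).2 hNdet
  have hsM := abs_sum_quadraticChar_le hF hM hMdet
  have hsN := abs_sum_quadraticChar_le hF hN hNdet
  have hsMN := abs_sum_quadraticChar_mul_le hF hM hN hMdet hMN
  have herr := (Finset.abs_sum_le_sum_abs _ _).trans <| Finset.sum_le_sum
    fun (v : Fin 3 → F) (_ : v ∈ Finset.univ) ↦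
      abs_four_mul_indicator_sub_le (v ⬝ᵥ M *ᵥ v) (v ⬝ᵥ N *ᵥ v)
  simp only [Finset.sum_sub_distrib, Finset.sum_add_distrib, ← Finset.mul_sum] at herr
  rw [← ternaryZeroCount, ← ternaryZeroCount, hZM, hZN] at herr
  simp only [Finset.sum_const, Finset.card_univ, Fintype.card_fun, Fintype.card_fin, nsmul_eq_mul,
    mul_one, Nat.cast_pow] at herr
  rw [abs_le] at *
  constructor <;> linarith [herr.1, herr.2, hsM.1, hsM.2, hsN.1, hsN.2, hsMN.1, hsMN.2]

end TernaryForms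

/-- Theorem 1.1: the number of points of `ℙ²(F_q)` external to the irreducible conic
`{f = 0}` and internal to the irreducible conic `{g = 0}` is `q²/4 + O(q^{3/2})`,
expressed via counts of nonzero vectors (each projective point corresponds to `q - 1`
nonzero vectors; for `n = 3` the sign `(-1)^{(n-1)/2}` is `-1`). -/
theorem external_internal_count_conics :
    ∃ C : ℝ, 0 < C ∧
      ∀ (q : ℕ) (F : Type) [Field F] [Fintype F],
        Fintype.card F = q → Odd q →
        ∀ M N : Matrix (Fin 3) (Fin 3) F,
          M.IsSymm → N.IsSymm → IsUnit M.det → IsUnit N.det →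
          (∀ c : F, N ≠ c • M) →
          abs (({v : Fin 3 → F | v ≠ 0 ∧
                (IsSquare (-M.det * (v ⬝ᵥ M.mulVec v)) ∧
                  -M.det * (v ⬝ᵥ M.mulVec v) ≠ 0) ∧
                ¬ IsSquare (-N.det * (v ⬝ᵥ N.mulVec v))}.ncard : ℝ)
              - ((q : ℝ) - 1) * (q : ℝ) ^ 2 / 4)
            ≤ C * ((q : ℝ) - 1) * (q : ℝ) ^ ((3 : ℝ) / 2) := by
  classical
  refine ⟨9, by norm_num, ?_⟩
  intro q F _ _ hq hodd M N hM hN hMdet hNdet hMN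
  have hMdet' := hMdet.ne_zero
  have hNdet' := hNdet.ne_zero
  have hF : ringChar F ≠ 2 := by
    intro h
    have := FiniteField.even_card_of_char_two h
    rw [hq] at this
    rcases hodd with ⟨k, hk⟩
    lia
  have hq3 : 3 ≤ q := by
    have : 1 < q := hq ▸ Fintype.one_lt_card
    rcases hodd with ⟨k, hk⟩
    lia
  have hpencil (t : F) : -M.det • M + t • (-N.det • N) ≠ 0 := by
    intro h
    by_cases ht : t = 0
    · have hM0 : M = 0 := by simpa [ht, hMdet'] using h
      simp [hM0] at hMdet'
    · have htN : t * N.det ≠ 0 := mul_ne_zero ht hNdet'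
      refine hMN (-M.det / (t * N.det)) ?_
      ext i j
      have hij := congrFun (congrFun h i) j
      simp only [Matrix.add_apply, Matrix.smul_apply, smul_eq_mul, Matrix.zero_apply] at hij ⊢
      field_simp
      linear_combination -hij
  have hbound := abs_four_mul_card_sub_le hF (hM.smul (-M.det)) (hN.smul (-N.det))
    (by rw [det_smul]; exact mul_ne_zero (pow_ne_zero _ (neg_ne_zero.mpr hMdet')) hMdet')
    (by rw [det_smul]; exact mul_ne_zero (pow_ne_zero _ (neg_ne_zero.mpr hNdet')) hNdet')
    hpencil
  simp only [smul_mulVec, dotProduct_smul, smul_eq_mul, hq] at hbound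
  set S : Set (Fin 3 → F) := {v | v ≠ 0 ∧ (IsSquare (-M.det * (v ⬝ᵥ M.mulVec v)) ∧
    -M.det * (v ⬝ᵥ M.mulVec v) ≠ 0) ∧ ¬ IsSquare (-N.det * (v ⬝ᵥ N.mulVec v))} with hS
  have hcard : (S.ncard : ℤ) = ∑ v : Fin 3 → F,
      if (IsSquare (-M.det * (v ⬝ᵥ M *ᵥ v)) ∧ -M.det * (v ⬝ᵥ M *ᵥ v) ≠ 0) ∧
        ¬IsSquare (-N.det * (v ⬝ᵥ N *ᵥ v)) then (1 : ℤ) else 0 := by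
    rw [Finset.sum_boole, ← Set.ncard_coe_finset]
    congr 2
    ext v
    simp only [hS, Set.mem_ofPred_eq, Finset.coe_filter, Finset.mem_univ, true_and,
      and_iff_right_iff_imp]
    rintro ⟨⟨-, h⟩, -⟩ rfl
    simp at h
  rw [← hcard] at hbound
  have hreal : |4 * (S.ncard : ℝ) - (q : ℝ) ^ 3| ≤ 21 * (q : ℝ) ^ 2 := by exact_mod_cast hbound
  have hq3' : (3 : ℝ) ≤ q := by exact_mod_cast hq3
  have hpow : (q : ℝ) ≤ (q : ℝ) ^ ((3 : ℝ) / 2) := by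
    simpa using Real.rpow_le_rpow_of_exponent_le (by linarith : (1 : ℝ) ≤ q)
      (by norm_num : (1 : ℝ) ≤ 3 / 2)
  have hmain : 9 * ((q : ℝ) - 1) * q ≤ 9 * ((q : ℝ) - 1) * (q : ℝ) ^ ((3 : ℝ) / 2) :=
    mul_le_mul_of_nonneg_left hpow (by linarith)
  refine le_trans ?_ hmain
  rw [abs_le] at *
  constructor <;> nlinarith [hreal.1, hreal.2]
end

section
/- Fix an odd integer n ≥ 3. There exists a constant C = C(n) > 0 such that the following holds. Let q be an odd prime power and let M, N be invertible symmetric n×n matrices over F_q such that N is not a scalar multiple of M (so the smooth quadrics {f=0} and {g=0} in P^{n−1} are distinct, where f(v) = vᵀMv and g(v) = vᵀNv). Then the number of nonzero vectors v ∈ F_q^n such that (−1)^{(n−1)/2}·det(M)·f(v) is a nonzero square in F_q and (−1)^{(n−1)/2}·det(N)·g(v) is a non-square in F_q satisfies |count − (q−1)·q^{n−1}/4| ≤ C·(q−1)·q^{n−3/2}. (Equivalently, the number of points P ∈ P^{n−1}(F_q) external to {f=0} and internal to {g=0} is q^{n−1}/4 + O(q^{n−3/2}).) -/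
open Matrix

section QuadraticExponentialSums

variable {F ι : Type*} [Field F] [Fintype F] [Fintype ι] [DecidableEq ι]

/-- The exponential sum attached to the quadratic form with matrix `A` and the additive
character `ψ`. -/
noncomputable def quadSum (ψ : AddChar F ℂ) (A : Matrix ι ι F) : ℂ :=
  ∑ v : ι → F, ψ (v ⬝ᵥ A *ᵥ v)

theorem AddChar.sum_dotProduct [DecidableEq F] {ψ : AddChar F ℂ} (hψ : ψ.IsPrimitive)
    (c : ι → F) :
    ∑ w : ι → F, ψ (c ⬝ᵥ w) = if c = 0 then (Fintype.card F : ℂ) ^ Fintype.card ι else 0 := by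
  split_ifs with h
  · simp [h]
  · obtain ⟨i, hi⟩ := Function.ne_iff.1 h
    let φ : AddChar (ι → F) ℂ := ψ.compAddMonoidHom
      { toFun := fun w => c ⬝ᵥ w, map_zero' := by simp, map_add' := dotProduct_add c }
    have hφ : φ ≠ 1 := by
      obtain ⟨x, hx⟩ := AddChar.ne_one_iff.1 (hψ hi)
      refine AddChar.ne_one_iff.2 ⟨Pi.single i x, ?_⟩
      simpa [φ] using hx
    exact AddChar.sum_eq_zero_of_ne_one hφ

theorem norm_quadSum_sq [DecidableEq F] (hF : ringChar F ≠ 2)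
    {ψ : AddChar F ℂ} (hψ : ψ.IsPrimitive) {A : Matrix ι ι F} (hA : A.IsSymm) :
    ‖quadSum ψ A‖ ^ 2 =
      (Fintype.card F : ℝ) ^ Fintype.card ι *
        (Finset.univ.filter fun u : ι → F => A *ᵥ u = 0).card := by
  have h2 : (2 : F) ≠ 0 := Ring.two_ne_zero hF
  have key : ∀ w u : ι → F,
      ψ ((w + u) ⬝ᵥ A *ᵥ (w + u)) * ψ (-(w ⬝ᵥ A *ᵥ w)) =
        ψ (u ⬝ᵥ A *ᵥ u) * ψ (((2 : F) • A *ᵥ u) ⬝ᵥ w) := by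
    intro w u
    rw [← AddChar.map_add_eq_mul, ← AddChar.map_add_eq_mul]
    congr 1
    have hs : u ⬝ᵥ A *ᵥ w = w ⬝ᵥ A *ᵥ u := by
      rw [dotProduct_mulVec, dotProduct_comm, ← mulVec_transpose, hA.eq]
    simp only [mulVec_add, add_dotProduct, dotProduct_add, hs, smul_dotProduct, smul_eq_mul,
      dotProduct_comm (A *ᵥ u) w]
    ring
  have hmain : quadSum ψ A * starRingEnd ℂ (quadSum ψ A) =
      (Fintype.card F : ℂ) ^ Fintype.card ι *
        (Finset.univ.filter fun u : ι → F => A *ᵥ u = 0).card := by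
    calc quadSum ψ A * starRingEnd ℂ (quadSum ψ A)
        = ∑ w : ι → F, ∑ v : ι → F, ψ (v ⬝ᵥ A *ᵥ v) * ψ (-(w ⬝ᵥ A *ᵥ w)) := by
          simp only [quadSum, map_sum, Finset.mul_sum, Finset.sum_mul, AddChar.map_neg_eq_conj]
      _ = ∑ w : ι → F, ∑ u : ι → F,
            ψ (u ⬝ᵥ A *ᵥ u) * ψ (((2 : F) • A *ᵥ u) ⬝ᵥ w) := by
          refine Finset.sum_congr rfl fun w _ => ?_
          rw [← Equiv.sum_comp (Equiv.addLeft w)]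
          exact Finset.sum_congr rfl fun u _ => key w u
      _ = ∑ u : ι → F, if A *ᵥ u = 0 then (Fintype.card F : ℂ) ^ Fintype.card ι else 0 := by
          rw [Finset.sum_comm]
          refine Finset.sum_congr rfl fun u _ => ?_
          rw [← Finset.mul_sum, AddChar.sum_dotProduct hψ]
          by_cases hu : A *ᵥ u = 0 <;> simp [hu, h2]
      _ = _ := by
          rw [← Finset.sum_filter, Finset.sum_const, nsmul_eq_mul, mul_comm]
  rw [Complex.mul_conj'] at hmain
  exact_mod_cast hmain

theorem card_ker_mulVec_mul_le [DecidableEq F] {A : Matrix ι ι F} (hA : A ≠ 0) :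
    (Finset.univ.filter fun u : ι → F => A *ᵥ u = 0).card * Fintype.card F ≤
      Fintype.card F ^ Fintype.card ι := by
  have hlt : Module.finrank F (LinearMap.ker A.toLin') < Module.finrank F (ι → F) := by
    refine Submodule.finrank_lt fun h => hA ?_
    simpa using LinearMap.ker_eq_top.1 h
  have hcard : (Finset.univ.filter fun u : ι → F => A *ᵥ u = 0).card =
      Fintype.card F ^ Module.finrank F (LinearMap.ker A.toLin') := by
    rw [← Nat.card_eq_fintype_card, ← Module.natCard_eq_pow_finrank, ← Fintype.card_subtype,
      ← Nat.card_eq_fintype_card]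
    exact Nat.card_congr (Equiv.subtypeEquivRight fun u => by simp)
  rw [Module.finrank_fintype_fun_eq_card] at hlt
  rw [hcard, ← pow_succ]
  exact Nat.pow_le_pow_right Fintype.card_pos hlt

theorem norm_quadSum_of_det_ne_zero (hF : ringChar F ≠ 2)
    {ψ : AddChar F ℂ} (hψ : ψ.IsPrimitive) {A : Matrix ι ι F} (hA : A.IsSymm) (hdet : A.det ≠ 0) :
    ‖quadSum ψ A‖ = √(Fintype.card F) ^ Fintype.card ι := by
  classical
  have hker : (Finset.univ.filter fun u : ι → F => A *ᵥ u = 0) = {0} := by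
    ext u
    simp only [Finset.mem_filter, Finset.mem_univ, true_and, Finset.mem_singleton]
    exact ⟨Matrix.eq_zero_of_mulVec_eq_zero hdet, fun h => by simp [h]⟩
  have h := norm_quadSum_sq hF hψ hA
  rw [hker, Finset.card_singleton, Nat.cast_one, mul_one] at h
  refine (pow_left_inj₀ (norm_nonneg _) (by positivity) two_ne_zero).1 ?_
  rw [h, ← pow_mul, mul_comm, pow_mul, Real.sq_sqrt (Nat.cast_nonneg _)]

theorem norm_quadSum_le_of_ne_zero (hF : ringChar F ≠ 2)
    {ψ : AddChar F ℂ} (hψ : ψ.IsPrimitive) {A : Matrix ι ι F} (hA : A.IsSymm) (h0 : A ≠ 0) :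
    ‖quadSum ψ A‖ ≤ √(Fintype.card F) ^ (2 * Fintype.card ι - 1) := by
  classical
  have hr : 0 < √(Fintype.card F : ℝ) := Real.sqrt_pos.2 (Nat.cast_pos.2 Fintype.card_pos)
  have hι : 1 ≤ Fintype.card ι := by
    rcases isEmpty_or_nonempty ι with h | h
    · exact absurd (Subsingleton.elim A 0) h0
    · exact Fintype.card_pos
  have hk : ((Finset.univ.filter fun u : ι → F => A *ᵥ u = 0).card : ℝ) * Fintype.card F ≤
      (Fintype.card F : ℝ) ^ Fintype.card ι := by exact_mod_cast card_ker_mulVec_mul_le h0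
  have h := norm_quadSum_sq hF hψ hA
  have hq : (Fintype.card F : ℝ) = √(Fintype.card F : ℝ) ^ 2 :=
    (Real.sq_sqrt (Nat.cast_nonneg _)).symm
  set r := √(Fintype.card F : ℝ)
  rw [hq] at h hk
  refine le_of_mul_le_mul_right (a := r) ?_ hr
  rw [← pow_succ, show 2 * Fintype.card ι - 1 + 1 = 2 * Fintype.card ι by omega, pow_mul]
  refine (pow_le_pow_iff_left₀ (by positivity) (by positivity) two_ne_zero).1 ?_
  rw [mul_pow, h, mul_assoc, sq ((r ^ 2) ^ _)]
  gcongr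

end QuadraticExponentialSums

section CharacterSums

variable {F ι : Type*} [Field F] [Fintype F] [DecidableEq F] [Fintype ι] [DecidableEq ι]

variable (F) in
/-- The quadratic character of a finite field with complex values. -/
noncomputable def complexQuadraticChar : MulChar F ℂ :=
  (quadraticChar F).ringHomComp (Int.castRingHom ℂ)

theorem complexQuadraticChar_apply (a : F) :
    complexQuadraticChar F a = (quadraticChar F a : ℂ) := rfl

theorem complexQuadraticChar_zero : complexQuadraticChar F 0 = 0 := by
  rw [complexQuadraticChar_apply, quadraticChar_zero, Int.cast_zero]

theorem norm_complexQuadraticChar_le (a : F) : ‖complexQuadraticChar F a‖ ≤ 1 := by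
  rcases quadraticChar_isQuadratic F a with h | h | h <;> simp [complexQuadraticChar_apply, h]

theorem complexQuadraticChar_ne_one (hF : ringChar F ≠ 2) : complexQuadraticChar F ≠ 1 :=
  (MulChar.ringHomComp_ne_one_iff Int.cast_injective).2 (quadraticChar_ne_one hF)

theorem complexQuadraticChar_isQuadratic : (complexQuadraticChar F).IsQuadratic :=
  (quadraticChar_isQuadratic F).comp _

theorem norm_gaussSum_complexQuadraticChar (hF : ringChar F ≠ 2) {ψ : AddChar F ℂ}
    (hψ : ψ.IsPrimitive) : ‖gaussSum (complexQuadraticChar F) ψ‖ = √(Fintype.card F) := by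
  have h := congrArg norm
    (gaussSum_sq (complexQuadraticChar_ne_one hF) complexQuadraticChar_isQuadratic hψ)
  have h1 : ‖complexQuadraticChar F (-1)‖ = 1 := by
    rcases quadraticChar_dichotomy (F := F) (a := -1) (by simp) with h | h <;>
      simp [complexQuadraticChar_apply, h]
  rw [norm_mul, h1, norm_pow, one_mul, Complex.norm_natCast] at h
  rw [← h, Real.sqrt_sq (norm_nonneg _)]

/-- The quadratic character is, up to the Gauss sum, its own Fourier transform. -/
theorem gaussSum_mul_complexQuadraticChar (hF : ringChar F ≠ 2) (ψ : AddChar F ℂ) (s : F) :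
    gaussSum (complexQuadraticChar F) ψ * complexQuadraticChar F s =
      ∑ a, complexQuadraticChar F a * ψ (a * s) := by
  by_cases hs : s = 0
  · simp [hs, complexQuadraticChar_zero,
      MulChar.sum_eq_zero_of_ne_one (complexQuadraticChar_ne_one hF)]
  · have h := gaussSum_mulShift_eq (complexQuadraticChar F) ψ (Units.mk0 s hs)
    rw [complexQuadraticChar_isQuadratic.inv] at h
    rw [mul_comm, ← Units.val_mk0 hs, ← h]
    simp [gaussSum, mul_comm]

theorem gaussSum_mul_sum_complexQuadraticChar (hF : ringChar F ≠ 2) (ψ : AddChar F ℂ)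
    (A : Matrix ι ι F) :
    gaussSum (complexQuadraticChar F) ψ * ∑ v : ι → F, complexQuadraticChar F (v ⬝ᵥ A *ᵥ v) =
      ∑ a, complexQuadraticChar F a * quadSum ψ (a • A) := by
  simp only [quadSum, Finset.mul_sum, gaussSum_mul_complexQuadraticChar hF]
  rw [Finset.sum_comm]
  simp [smul_mulVec, dotProduct_smul]

theorem gaussSum_sq_mul_sum_complexQuadraticChar (hF : ringChar F ≠ 2) (ψ : AddChar F ℂ)
    (A B : Matrix ι ι F) :
    gaussSum (complexQuadraticChar F) ψ ^ 2 *
        ∑ v : ι → F, complexQuadraticChar F (v ⬝ᵥ A *ᵥ v) * complexQuadraticChar F (v ⬝ᵥ B *ᵥ v) =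
      ∑ a, ∑ b, complexQuadraticChar F a * complexQuadraticChar F b * quadSum ψ (a • A + b • B) := by
  have h : ∀ x y : F, gaussSum (complexQuadraticChar F) ψ ^ 2 *
      (complexQuadraticChar F x * complexQuadraticChar F y) =
      ∑ a, ∑ b, complexQuadraticChar F a * complexQuadraticChar F b * ψ (a * x + b * y) := by
    intro x y
    rw [sq, mul_mul_mul_comm, gaussSum_mul_complexQuadraticChar hF,
      gaussSum_mul_complexQuadraticChar hF, Finset.sum_mul_sum]
    simp only [AddChar.map_add_eq_mul, mul_mul_mul_comm]
  simp only [quadSum, Finset.mul_sum, h]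
  rw [Finset.sum_comm]
  refine Finset.sum_congr rfl fun a _ => ?_
  rw [Finset.sum_comm]
  simp [add_mulVec, smul_mulVec, dotProduct_smul, dotProduct_add]

theorem norm_sum_complexQuadraticChar_le (hF : ringChar F ≠ 2)
    {A : Matrix ι ι F} (hA : A.IsSymm) (hdet : A.det ≠ 0) :
    ‖∑ v : ι → F, complexQuadraticChar F (v ⬝ᵥ A *ᵥ v)‖ ≤
      √(Fintype.card F) ^ (Fintype.card ι + 1) := by
  obtain ⟨ψ, hψ⟩ : ∃ ψ : AddChar F ℂ, ψ.IsPrimitive :=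
    ⟨_, AddChar.FiniteField.primitiveChar_to_Complex_isPrimitive F⟩
  have hr : 0 < √(Fintype.card F : ℝ) := Real.sqrt_pos.2 (Nat.cast_pos.2 Fintype.card_pos)
  have h := congrArg norm (gaussSum_mul_sum_complexQuadraticChar hF ψ A)
  rw [norm_mul, norm_gaussSum_complexQuadraticChar hF hψ] at h
  refine le_of_mul_le_mul_left (h.trans_le ?_) hr
  calc _ ≤ ∑ _a : F, √(Fintype.card F : ℝ) ^ Fintype.card ι := by
        refine norm_sum_le_of_le _ fun a _ => ?_
        by_cases ha : a = 0
        · simp [ha, complexQuadraticChar_zero]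
        · have hd : (a • A).det ≠ 0 := by simp [ha, hdet]
          rw [norm_mul, norm_quadSum_of_det_ne_zero hF hψ (hA.smul a) hd]
          exact mul_le_of_le_one_left (by positivity) (norm_complexQuadraticChar_le a)
    _ = _ := by
        rw [Finset.sum_const, Finset.card_univ, nsmul_eq_mul]
        conv_lhs => rw [← Real.mul_self_sqrt (Nat.cast_nonneg (α := ℝ) (Fintype.card F))]
        rw [Real.sqrt_mul_self hr.le]
        ring

theorem card_filter_det_add_smul_eq_zero_le {A : Matrix ι ι F}
    (hdet : A.det ≠ 0) (B : Matrix ι ι F) :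
    (Finset.univ.filter fun b : F => (A + b • B).det = 0).card ≤ Fintype.card ι := by
  open Polynomial in
  set p : F[X] := det ((X : F[X]) • B.map C + A.map C) with hp
  have heval : ∀ b, p.eval b = (A + b • B).det := by
    intro b
    rw [hp, ← coe_evalRingHom, RingHom.map_det]
    congr 1
    ext i j
    simp [add_comm (A i j), mul_comm b]
  have hp0 : p ≠ 0 := by
    intro h
    have := heval 0
    simp [h] at this
    exact hdet this.symm
  calc _ ≤ p.roots.toFinset.card := by
        refine Finset.card_le_card fun b hb => ?_
        simpa [hp0, Polynomial.IsRoot, heval] using hb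
    _ ≤ p.roots.card := Multiset.toFinset_card_le _
    _ ≤ p.natDegree := p.card_roots'
    _ ≤ _ := Polynomial.natDegree_det_X_add_C_le B A

theorem norm_sum_complexQuadraticChar_mul_le (hF : ringChar F ≠ 2)
    (hι : 3 ≤ Fintype.card ι) {A B : Matrix ι ι F} (hA : A.IsSymm) (hB : B.IsSymm)
    (hdet : A.det ≠ 0) (hAB : ∀ c : F, B ≠ c • A) :
    ‖∑ v : ι → F, complexQuadraticChar F (v ⬝ᵥ A *ᵥ v) * complexQuadraticChar F (v ⬝ᵥ B *ᵥ v)‖ ≤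
      (Fintype.card ι + 1) * √(Fintype.card F) ^ (2 * Fintype.card ι - 1) := by
  obtain ⟨ψ, hψ⟩ : ∃ ψ : AddChar F ℂ, ψ.IsPrimitive :=
    ⟨_, AddChar.FiniteField.primitiveChar_to_Complex_isPrimitive F⟩
  have hr : 0 < √(Fintype.card F : ℝ) := Real.sqrt_pos.2 (Nat.cast_pos.2 Fintype.card_pos)
  have hr1 : 1 ≤ √(Fintype.card F : ℝ) :=
    Real.one_le_sqrt.2 (Nat.one_le_cast.2 Fintype.card_pos)
  have hq : (Fintype.card F : ℝ) = √(Fintype.card F : ℝ) ^ 2 :=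
    (Real.sq_sqrt (Nat.cast_nonneg _)).symm
  have h := congrArg norm (gaussSum_sq_mul_sum_complexQuadraticChar hF ψ A B)
  rw [norm_mul, norm_pow, norm_gaussSum_complexQuadraticChar hF hψ] at h
  refine le_of_mul_le_mul_left (h.trans_le ?_) (pow_pos hr 2)
  set r := √(Fintype.card F : ℝ)
  set n := Fintype.card ι with hn
  have hinner : ∀ a : F, ‖∑ b, complexQuadraticChar F a * complexQuadraticChar F b *
      quadSum ψ (a • A + b • B)‖ ≤ (n + 1) * r ^ (2 * n - 1) := by
    intro a
    by_cases ha : a = 0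
    · simp only [ha, complexQuadraticChar_zero, zero_mul, Finset.sum_const_zero, norm_zero]
      positivity
    have hda : (a • A).det ≠ 0 := by simp [ha, hdet]
    have hne : ∀ b : F, a • A + b • B ≠ 0 := by
      intro b hb
      by_cases hb0 : b = 0
      · rw [hb0, zero_smul, add_zero] at hb
        have : Nonempty ι := Fintype.card_pos_iff.1 (by omega)
        exact hda (by rw [hb, det_zero])
      · refine hAB (-(b⁻¹ * a)) ?_
        rw [neg_smul, mul_smul, eq_neg_of_add_eq_zero_left hb, smul_neg, neg_neg,
          inv_smul_smul₀ hb0]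
    calc _ ≤ ∑ b : F, (r ^ n + if (a • A + b • B).det = 0 then r ^ (2 * n - 1) else 0) := by
          refine norm_sum_le_of_le _ fun b _ => ?_
          have hs : (a • A + b • B).IsSymm := (hA.smul a).add (hB.smul b)
          rw [norm_mul, norm_mul]
          refine (mul_le_of_le_one_left (norm_nonneg _) (mul_le_one₀
            (norm_complexQuadraticChar_le a) (norm_nonneg _)
            (norm_complexQuadraticChar_le b))).trans ?_
          split_ifs with hd
          · exact (norm_quadSum_le_of_ne_zero hF hψ hs (hne b)).trans
              (le_add_of_nonneg_left (by positivity))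
          · rw [norm_quadSum_of_det_ne_zero hF hψ hs hd, add_zero]
      _ = r ^ (n + 2) + (Finset.univ.filter fun b : F => (a • A + b • B).det = 0).card *
            r ^ (2 * n - 1) := by
          rw [Finset.sum_add_distrib, ← Finset.sum_filter, Finset.sum_const, Finset.sum_const,
            nsmul_eq_mul, nsmul_eq_mul, Finset.card_univ, hq]
          ring
      _ ≤ r ^ (2 * n - 1) + n * r ^ (2 * n - 1) := by
          gcongr
          · omega
          · exact card_filter_det_add_smul_eq_zero_le hda B
      _ = _ := by ring
  calc _ ≤ ∑ _a : F, (n + 1) * r ^ (2 * n - 1) := norm_sum_le_of_le _ fun a _ => hinner a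
    _ = _ := by
      rw [Finset.sum_const, Finset.card_univ, nsmul_eq_mul, hq]

theorem card_zeros_quadForm_le (hF : ringChar F ≠ 2)
    (hι : 3 ≤ Fintype.card ι) {A : Matrix ι ι F} (hA : A.IsSymm) (hdet : A.det ≠ 0) :
    ((Finset.univ.filter fun v : ι → F => v ⬝ᵥ A *ᵥ v = 0).card : ℝ) ≤
      2 * √(Fintype.card F) ^ (2 * Fintype.card ι - 1) := by
  obtain ⟨ψ, hψ⟩ : ∃ ψ : AddChar F ℂ, ψ.IsPrimitive :=
    ⟨_, AddChar.FiniteField.primitiveChar_to_Complex_isPrimitive F⟩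
  have hr : 0 < √(Fintype.card F : ℝ) := Real.sqrt_pos.2 (Nat.cast_pos.2 Fintype.card_pos)
  have hr1 : 1 ≤ √(Fintype.card F : ℝ) :=
    Real.one_le_sqrt.2 (Nat.one_le_cast.2 Fintype.card_pos)
  have hq : (Fintype.card F : ℝ) = √(Fintype.card F : ℝ) ^ 2 :=
    (Real.sq_sqrt (Nat.cast_nonneg _)).symm
  have hcount : ((Fintype.card F *
      (Finset.univ.filter fun v : ι → F => v ⬝ᵥ A *ᵥ v = 0).card : ℕ) : ℂ) =
        ∑ a : F, quadSum ψ (a • A) := by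
    simp only [quadSum, smul_mulVec, dotProduct_smul, smul_eq_mul]
    rw [Finset.sum_comm]
    simp only [AddChar.sum_mulShift (ψ := ψ) _ hψ]
    rw [Nat.cast_mul, mul_comm, Finset.card_filter]
    push_cast
    rw [Finset.sum_mul]
    simp
  have h := congrArg norm hcount
  rw [Complex.norm_natCast, Nat.cast_mul] at h
  set r := √(Fintype.card F : ℝ)
  set n := Fintype.card ι with hn
  rw [hq] at h
  refine le_of_mul_le_mul_left (h.trans_le ?_) (pow_pos hr 2)
  calc _ ≤ ∑ a : F, ((if a = 0 then r ^ (2 * n) else 0) + r ^ n) := by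
        refine norm_sum_le_of_le _ fun a _ => ?_
        split_ifs with ha
        · have h0 : ‖quadSum ψ (a • A)‖ = r ^ (2 * n) := by
            simp [quadSum, ha, pow_mul, ← hq, ← hn]
          rw [h0]
          exact le_add_of_nonneg_right (by positivity)
        · have hd : (a • A).det ≠ 0 := by simp [ha, hdet]
          rw [norm_quadSum_of_det_ne_zero hF hψ (hA.smul a) hd, zero_add]
    _ = r ^ (2 * n) + r ^ (n + 2) := by
        rw [Finset.sum_add_distrib, Finset.sum_const, Finset.card_univ, nsmul_eq_mul, hq]
        simp
        ring
    _ ≤ r ^ (2 * n - 1 + 2) + r ^ (2 * n - 1 + 2) := by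
        gcongr <;> first | assumption | omega
    _ = _ := by ring

theorem norm_indicator_sub_le (x y : F) :
    ‖(if IsSquare x ∧ x ≠ 0 ∧ ¬ IsSquare y then 1 else 0 : ℂ) -
        (1 + complexQuadraticChar F x) * (1 - complexQuadraticChar F y) / 4‖ ≤
      (if x = 0 then 1 else 0) + (if y = 0 then 1 else 0) := by
  simp only [complexQuadraticChar_apply]
  by_cases hx : x = 0 <;> by_cases hy : y = 0
  · norm_num [hx, hy]
  · rcases quadraticChar_dichotomy hy with h | h <;> norm_num [hx, hy, h]
  · rcases quadraticChar_dichotomy hx with h | h <;> norm_num [hx, hy, h]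
  · by_cases hsx : IsSquare x <;> by_cases hsy : IsSquare y
    · simp [hsx, hsy, hx, hy, (quadraticChar_one_iff_isSquare hy).2 hsy]
    · norm_num [hsx, hsy, hx, hy, (quadraticChar_one_iff_isSquare hx).2 hsx,
        quadraticChar_neg_one_iff_not_isSquare.2 hsy]
    · simp [hsx, hsy, hx, hy, (quadraticChar_one_iff_isSquare hy).2 hsy]
    · simp [hsx, hsy, hx, hy, quadraticChar_neg_one_iff_not_isSquare.2 hsx]

theorem abs_card_isSquare_not_isSquare_sub_le (hF : ringChar F ≠ 2)
    (hι : 3 ≤ Fintype.card ι) {A B : Matrix ι ι F} (hA : A.IsSymm) (hB : B.IsSymm)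
    (hdA : A.det ≠ 0) (hdB : B.det ≠ 0) (hAB : ∀ c : F, B ≠ c • A) :
    |((Finset.univ.filter fun v : ι → F => IsSquare (v ⬝ᵥ A *ᵥ v) ∧ v ⬝ᵥ A *ᵥ v ≠ 0 ∧
          ¬ IsSquare (v ⬝ᵥ B *ᵥ v)).card : ℝ) - (Fintype.card F : ℝ) ^ Fintype.card ι / 4| ≤
      (Fintype.card ι + 19) / 4 * √(Fintype.card F) ^ (2 * Fintype.card ι - 1) := by
  have hr1 : 1 ≤ √(Fintype.card F : ℝ) :=
    Real.one_le_sqrt.2 (Nat.one_le_cast.2 Fintype.card_pos)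
  have hpow : √(Fintype.card F : ℝ) ^ (Fintype.card ι + 1) ≤
      √(Fintype.card F : ℝ) ^ (2 * Fintype.card ι - 1) :=
    pow_le_pow_right₀ hr1 (by omega)
  have hTA := (norm_sum_complexQuadraticChar_le hF hA hdA).trans hpow
  have hTB := (norm_sum_complexQuadraticChar_le hF hB hdB).trans hpow
  have hT := norm_sum_complexQuadraticChar_mul_le hF hι hA hB hdA hAB
  have hZA := card_zeros_quadForm_le hF hι hA hdA
  have hZB := card_zeros_quadForm_le hF hι hB hdB
  set R := √(Fintype.card F : ℝ) ^ (2 * Fintype.card ι - 1)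
  set TA := ∑ v : ι → F, complexQuadraticChar F (v ⬝ᵥ A *ᵥ v) with hTAdef
  set TB := ∑ v : ι → F, complexQuadraticChar F (v ⬝ᵥ B *ᵥ v) with hTBdef
  set T := ∑ v : ι → F,
    complexQuadraticChar F (v ⬝ᵥ A *ᵥ v) * complexQuadraticChar F (v ⬝ᵥ B *ᵥ v) with hTdef
  set S := Finset.univ.filter fun v : ι → F => IsSquare (v ⬝ᵥ A *ᵥ v) ∧ v ⬝ᵥ A *ᵥ v ≠ 0 ∧
    ¬ IsSquare (v ⬝ᵥ B *ᵥ v)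
  have hE : ‖∑ v : ι → F, ((if IsSquare (v ⬝ᵥ A *ᵥ v) ∧ v ⬝ᵥ A *ᵥ v ≠ 0 ∧
      ¬ IsSquare (v ⬝ᵥ B *ᵥ v) then 1 else 0 : ℂ) -
        (1 + complexQuadraticChar F (v ⬝ᵥ A *ᵥ v)) *
          (1 - complexQuadraticChar F (v ⬝ᵥ B *ᵥ v)) / 4)‖ ≤ 4 * R := by
    refine (norm_sum_le_of_le _ fun v _ => norm_indicator_sub_le _ _).trans ?_
    rw [Finset.sum_add_distrib, Finset.sum_boole, Finset.sum_boole]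
    linarith
  set E := ∑ v : ι → F, ((if IsSquare (v ⬝ᵥ A *ᵥ v) ∧ v ⬝ᵥ A *ᵥ v ≠ 0 ∧
      ¬ IsSquare (v ⬝ᵥ B *ᵥ v) then 1 else 0 : ℂ) -
        (1 + complexQuadraticChar F (v ⬝ᵥ A *ᵥ v)) *
          (1 - complexQuadraticChar F (v ⬝ᵥ B *ᵥ v)) / 4) with hEdef
  have hsum : (S.card : ℂ) - (Fintype.card F : ℂ) ^ Fintype.card ι / 4 =
      E + (TA - TB - T) / 4 := by
    rw [hEdef, Finset.sum_sub_distrib, Finset.sum_boole, ← Finset.sum_div]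
    have : ∀ v : ι → F, (1 + complexQuadraticChar F (v ⬝ᵥ A *ᵥ v)) *
          (1 - complexQuadraticChar F (v ⬝ᵥ B *ᵥ v)) =
        1 + complexQuadraticChar F (v ⬝ᵥ A *ᵥ v) - complexQuadraticChar F (v ⬝ᵥ B *ᵥ v) -
          complexQuadraticChar F (v ⬝ᵥ A *ᵥ v) * complexQuadraticChar F (v ⬝ᵥ B *ᵥ v) :=
      fun v => by ring
    simp only [this, Finset.sum_sub_distrib, Finset.sum_add_distrib, ← hTAdef, ← hTBdef, ← hTdef,
      Finset.sum_const, Finset.card_univ, Fintype.card_fun, nsmul_eq_mul, mul_one, Nat.cast_pow]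
    ring
  have hnorm : |(S.card : ℝ) - (Fintype.card F : ℝ) ^ Fintype.card ι / 4| =
      ‖E + (TA - TB - T) / 4‖ := by
    rw [← hsum, ← Real.norm_eq_abs, ← Complex.norm_real]
    push_cast
    rfl
  rw [hnorm]
  have h1 := norm_add_le E ((TA - TB - T) / 4)
  have h2 : ‖(TA - TB - T) / 4‖ = ‖TA - TB - T‖ / 4 := by simp
  have h3 := norm_sub_le (TA - TB) T
  have h4 := norm_sub_le TA TB
  linarith

end CharacterSums

/-- Theorem 1.2: for a fixed odd `n ≥ 3`, the number of points of `ℙ^{n-1}(F_q)` external to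
the smooth quadric `{f = 0}` and internal to the smooth quadric `{g = 0}` is
`q^{n-1}/4 + O(q^{n-3/2})`, expressed via counts of nonzero vectors (each projective point
corresponds to `q - 1` nonzero vectors). -/
theorem external_internal_count (n : ℕ) (hodd : Odd n) (hn : 3 ≤ n) :
    ∃ C : ℝ, 0 < C ∧
      ∀ (q : ℕ) (F : Type) [Field F] [Fintype F],
        Fintype.card F = q → Odd q →
        ∀ M N : Matrix (Fin n) (Fin n) F,
          M.IsSymm → N.IsSymm → IsUnit M.det → IsUnit N.det →
          (∀ c : F, N ≠ c • M) →
          abs (({v : Fin n → F | v ≠ 0 ∧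
                (IsSquare ((-1) ^ ((n - 1) / 2) * M.det * (v ⬝ᵥ M.mulVec v)) ∧
                  (-1) ^ ((n - 1) / 2) * M.det * (v ⬝ᵥ M.mulVec v) ≠ 0) ∧
                ¬ IsSquare ((-1) ^ ((n - 1) / 2) * N.det * (v ⬝ᵥ N.mulVec v))}.ncard : ℝ)
              - ((q : ℝ) - 1) * (q : ℝ) ^ (n - 1) / 4)
            ≤ C * ((q : ℝ) - 1) * (q : ℝ) ^ ((n : ℝ) - 3 / 2) := by
  refine ⟨n + 20, by positivity, ?_⟩
  rintro q F _ _ rfl hq M N hM hN hdM hdN hMN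
  classical
  have hF : ringChar F ≠ 2 := fun h =>
    Nat.not_even_iff_odd.2 hq (Nat.even_iff.2 (FiniteField.even_card_iff_char_two.1 h))
  have hsign : ((-1) ^ ((n - 1) / 2) : F) ≠ 0 := pow_ne_zero _ (by simp)
  have hcM : (-1) ^ ((n - 1) / 2) * M.det ≠ 0 := mul_ne_zero hsign hdM.ne_zero
  have hcN : (-1) ^ ((n - 1) / 2) * N.det ≠ 0 := mul_ne_zero hsign hdN.ne_zero
  set a := (-1) ^ ((n - 1) / 2) * M.det
  set b := (-1) ^ ((n - 1) / 2) * N.det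
  have key := abs_card_isSquare_not_isSquare_sub_le hF (by simpa using hn) (hM.smul a) (hN.smul b)
    (by simp [hcM, hdM.ne_zero]) (by simp [hcN, hdN.ne_zero])
    (fun c h => hMN (b⁻¹ * (c * a)) (by rw [mul_smul, mul_smul, ← h, inv_smul_smul₀ hcN]))
  simp only [smul_mulVec, dotProduct_smul, smul_eq_mul, Fintype.card_fin] at key
  have hset : {v : Fin n → F | v ≠ 0 ∧ (IsSquare (a * (v ⬝ᵥ M *ᵥ v)) ∧ a * (v ⬝ᵥ M *ᵥ v) ≠ 0) ∧
      ¬ IsSquare (b * (v ⬝ᵥ N *ᵥ v))} =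
      ((Finset.univ.filter fun v : Fin n → F => IsSquare (a * (v ⬝ᵥ M *ᵥ v)) ∧
        a * (v ⬝ᵥ M *ᵥ v) ≠ 0 ∧ ¬ IsSquare (b * (v ⬝ᵥ N *ᵥ v)) : Finset (Fin n → F)) :
          Set (Fin n → F)) := by
    ext v
    simp only [Set.mem_ofPred_eq, Finset.coe_filter, Finset.mem_univ, true_and, and_assoc]
    refine ⟨fun h => h.2, fun h => ⟨?_, h⟩⟩
    rintro rfl
    simp at h
  rw [hset, Set.ncard_coe_finset]
  have hq2 : (2 : ℝ) ≤ Fintype.card F := by exact_mod_cast Fintype.one_lt_card (α := F)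
  have hr1 : 1 ≤ √(Fintype.card F : ℝ) := Real.one_le_sqrt.2 (by linarith)
  have hqr : (Fintype.card F : ℝ) = √(Fintype.card F : ℝ) ^ 2 :=
    (Real.sq_sqrt (Nat.cast_nonneg _)).symm
  have hrpow : (Fintype.card F : ℝ) ^ ((n : ℝ) - 3 / 2) =
      √(Fintype.card F : ℝ) ^ (2 * n - 3) := by
    rw [Real.sqrt_eq_rpow, ← Real.rpow_natCast, ← Real.rpow_mul (Nat.cast_nonneg _)]
    congr 1
    rw [Nat.cast_sub (by omega)]
    push_cast
    ring
  have hR : √(Fintype.card F : ℝ) ^ (2 * n - 1) =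
      Fintype.card F * √(Fintype.card F : ℝ) ^ (2 * n - 3) := by
    conv_rhs => rw [hqr, Real.sqrt_sq (by positivity)]
    rw [← pow_add]
    congr 1
    omega
  have hlow : (Fintype.card F : ℝ) ^ (n - 1) ≤ √(Fintype.card F : ℝ) ^ (2 * n - 1) := by
    conv_lhs => rw [hqr, ← pow_mul]
    exact pow_le_pow_right₀ hr1 (by omega)
  have hsplit : (Fintype.card F : ℝ) ^ n = Fintype.card F * (Fintype.card F : ℝ) ^ (n - 1) := by
    rw [← pow_succ', Nat.sub_add_cancel (by omega)]
  rw [hrpow]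
  rw [hR] at key hlow
  rw [hsplit] at key
  have hP : 0 ≤ √(Fintype.card F : ℝ) ^ (2 * n - 3) := by positivity
  set P := √(Fintype.card F : ℝ) ^ (2 * n - 3)
  set Q := (Fintype.card F : ℝ)
  have hQ0 : 0 ≤ Q ^ (n - 1) := by positivity
  have hfin : ((n : ℝ) + 20) / 4 * (Q * P) ≤ (n + 20) * (Q - 1) * P := by
    have : 0 ≤ ((n : ℝ) + 20) * P * (Q - 1 - Q / 4) :=
      mul_nonneg (by positivity) (by linarith)
    linarith
  rw [abs_le] at key ⊢
  constructor <;> linarith [key.1, key.2]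
end

section
/- Let F be a field (e.g. F_q with q odd), let n ≥ 1, let a_0, a_1, …, a_n be nonzero elements of F, let c_0 = 1, and let c_1, …, c_n ∈ F. Let B be the (n+1)×n matrix whose first row is (c_1, c_2, …, c_n) and whose remaining n rows form the identity matrix I_n, and let D = diag(a_0, a_1, …, a_n). Then the n×n matrix E = Bᵀ·D·B satisfies det(E) = (a_0·a_1⋯a_n)·Σ_{i=0}^{n} c_i²/a_i. -/
open Matrix

/-- Lemma 2.2: if `B` is the `(n+1) × n` matrix whose first row is `(c_1, …, c_n)` (with
`c_0 = 1`) and whose remaining rows form the identity, and `D = diag(a_0, …, a_n)` with all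
`a_i ≠ 0`, then `det (Bᵀ D B) = (a_0 ⋯ a_n) · Σ_i c_i² / a_i`. -/
theorem det_transpose_diagonal_mul (F : Type) [Field F] (n : ℕ) (hn : 1 ≤ n)
    (a : Fin (n + 1) → F) (ha : ∀ i, a i ≠ 0)
    (c : Fin (n + 1) → F) (hc : c 0 = 1)
    (B : Matrix (Fin (n + 1)) (Fin n) F)
    (hB0 : ∀ j : Fin n, B 0 j = c j.succ)
    (hB1 : ∀ i j : Fin n, B i.succ j = if i = j then 1 else 0) :
    (Bᵀ * Matrix.diagonal a * B).det = (∏ i, a i) * ∑ i, (c i) ^ 2 / a i := by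
  have key : Bᵀ * Matrix.diagonal a * B = Matrix.diagonal (fun i : Fin n => a i.succ) *
      (1 + replicateCol Unit (fun i : Fin n => a 0 * c i.succ / a i.succ) *
        replicateRow Unit (fun i : Fin n => c i.succ)) := by
    ext i j
    have h := ha i.succ
    rw [Matrix.mul_apply, Fin.sum_univ_succ, Matrix.diagonal_mul]
    simp only [Matrix.mul_diagonal]
    simp only [Matrix.transpose_apply, hB0, hB1, Matrix.add_apply,
      Matrix.one_apply, Matrix.mul_apply, replicateCol_apply, replicateRow_apply,
      Finset.univ_unique, Finset.sum_const, Finset.card_singleton, one_smul, ite_mul, one_mul,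
      zero_mul, Finset.sum_ite_eq', Finset.mem_univ, if_true, mul_ite, mul_one, mul_zero]
    obtain rfl | hij := eq_or_ne i j
    · simp only [if_true]
      field_simp
      ring
    · simp only [hij, hij.symm, if_false]
      field_simp
      ring
  rw [key, det_mul, det_diagonal, det_one_add_replicateCol_mul_replicateRow,
    Fin.prod_univ_succ, Fin.sum_univ_succ, hc, mul_comm (a 0), mul_assoc, mul_add (a 0),
    Finset.mul_sum, one_pow, mul_one_div_cancel (ha 0), dotProduct]
  congr 2
  exact Finset.sum_congr rfl fun i _ => by ring
end

section
/- Let q be an odd prime power, let n ≥ 2, and let a_0, a_1, …, a_{n−1} be nonzero elements of F_q. Define the diagonal quadratic form F(x_0, …, x_{n−1}) = a_0x_0² + a_1x_1² + ⋯ + a_{n−1}x_{n−1}², with diagonal matrix A = diag(a_0, …, a_{n−1}). Let P = (1, p_1, …, p_{n−1}) ∈ F_q^n, and let B be the n×(n−1) matrix whose first row is (−p_1, −p_2, …, −p_{n−1}) and whose remaining n−1 rows form the identity matrix I_{n−1}. Then det(Bᵀ·A^{−1}·B) = F(P)/det(A). (This computes the discriminant of the quadratic form G_P cutting out the hyperplane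 section H_P* ∩ X* of the dual quadric; hence disc(G_P) = F(P)/disc(F) in F_q*/(F_q*)², which is the paper's Lemma 2.1.) -/
open Matrix

/-- The matrix determinant lemma for a rank-one perturbation of an invertible diagonal matrix. -/
theorem det_diagonal_inv_add_vecMulVec {K n : Type*} [Field K] [Fintype n] [DecidableEq n]
    (d : n → K) (hd : ∀ i, d i ≠ 0) (u v : n → K) :
    (diagonal (fun i => (d i)⁻¹) + vecMulVec u v).det
      = (∏ i, d i)⁻¹ * (1 + ∑ i, d i * (u i * v i)) := by
  have h : diagonal (fun i => (d i)⁻¹) + vecMulVec u v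
      = diagonal (fun i => (d i)⁻¹)
        * (1 + replicateCol Unit (fun i => d i * u i) * replicateRow Unit v) := by
    rw [Matrix.mul_add, Matrix.mul_one, ← vecMulVec_eq]
    congr 1
    ext i j
    simp [diagonal_mul, vecMulVec_apply, mul_assoc, hd i]
  rw [h, det_mul, det_diagonal, det_one_add_replicateCol_mul_replicateRow,
    Finset.prod_inv_distrib, dotProduct]
  congr 2
  exact Finset.sum_congr rfl fun i _ => by ring

/-- Lemma 2.1: the discriminant of the quadratic form `G_P` cutting out the hyperplane
section `H_P* ∩ X*` of the dual quadric is `F(P)/disc(F)`.  Concretely, with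
`A = diag(a_0, …, a_{n-1})` (all `a_i ≠ 0`, here `n = m + 1`), `P = (1, p_1, …, p_{n-1})`,
and `B` the `n × (n-1)` matrix with first row `(-p_1, …, -p_{n-1})` and remaining rows the
identity, we have `det (Bᵀ A⁻¹ B) = F(P) / det A` where `F(x) = Σ a_i x_i²`. -/
theorem disc_hyperplane_section (q : ℕ) (hq : Odd q)
    (F : Type) [Field F] [Fintype F] (hcard : Fintype.card F = q)
    (m : ℕ) (hm : 1 ≤ m)
    (a : Fin (m + 1) → F) (ha : ∀ i, a i ≠ 0)
    (P : Fin (m + 1) → F) (hP : P 0 = 1)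
    (B : Matrix (Fin (m + 1)) (Fin m) F)
    (hB0 : ∀ j : Fin m, B 0 j = -P j.succ)
    (hB1 : ∀ i j : Fin m, B i.succ j = if i = j then 1 else 0) :
    (Bᵀ * (Matrix.diagonal a)⁻¹ * B).det
      = (∑ i, a i * (P i) ^ 2) / (Matrix.diagonal a).det := by
  have hinv : (diagonal a)⁻¹ = diagonal (fun i => (a i)⁻¹) := by
    refine inv_eq_left_inv ?_
    rw [diagonal_mul_diagonal, ← diagonal_one]
    exact congrArg diagonal (funext fun i => inv_mul_cancel₀ (ha i))
  have hgram : Bᵀ * (diagonal a)⁻¹ * B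
      = diagonal (fun j : Fin m => (a j.succ)⁻¹)
        + vecMulVec (fun j => (a 0)⁻¹ * P j.succ) (fun j => P j.succ) := by
    ext i j
    rw [hinv, Matrix.mul_apply, Fin.sum_univ_succ]
    rcases eq_or_ne i j with rfl | hij
    · simp [mul_diagonal, hB0, hB1, vecMulVec_apply]
      ring
    · simp [mul_diagonal, hB0, hB1, vecMulVec_apply, hij, hij.symm,
        mul_comm (P i.succ)]
  have hsum : ∑ j : Fin m, a j.succ * ((a 0)⁻¹ * P j.succ * P j.succ)
      = (a 0)⁻¹ * ∑ j : Fin m, a j.succ * P j.succ ^ 2 := by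
    rw [Finset.mul_sum]
    exact Finset.sum_congr rfl fun j _ => by ring
  have hprod : ∏ j : Fin m, a j.succ ≠ 0 := Finset.prod_ne_zero_iff.mpr fun j _ => ha j.succ
  have ha0 := ha 0
  rw [hgram, det_diagonal_inv_add_vecMulVec (fun j : Fin m => a j.succ) (fun j => ha j.succ),
    hsum, det_diagonal, Fin.prod_univ_succ, Fin.sum_univ_succ, hP]
  field_simp
end

section
/- Let q be an odd prime power, let M be an invertible symmetric 3×3 matrix over F_q, set f(v) = vᵀMv, and let v ∈ F_q³ be a vector with f(v) ≠ 0. Call a 2-dimensional linear subspace W ⊆ F_q³ tangent to the conic {f=0} if there is exactly one 1-dimensional subspace L ⊆ W on which f vanishes identically. Then the number of 2-dimensional subspaces W containing v that are tangent to {f=0} equals 2 if (−det M)·f(v) is a nonzero square in F_q, and equals 0 if (−det M)·f(v) is a non-square in F_q. (This is the planar case n = 3 of the paper's Lemma 2.3: a point off an irreducible conic is external, i.e. lies on exactly two tangent F_q-lines, if and only if (−1)^{(3−1)/2}·det(M)·f(P) is a nonzero square, and internal, i.e. lies on no tangent F_q-line, otherwise.) -/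
open Matrix

open Module

theorem exists_linearIndependent_isOrtho {K V : Type*} [Field K] [AddCommGroup V]
    [Module K V] (h2 : (2 : K) ≠ 0) (hV : finrank K V = 3) {B : LinearMap.BilinForm K V}
    (hB : B.IsSymm) {v : V} (hv : B v v ≠ 0) :
    ∃ u w : V, LinearIndependent K ![v, u, w] ∧ B v u = 0 ∧ B v w = 0 ∧ B u w = 0 := by
  have : FiniteDimensional K V := FiniteDimensional.of_finrank_pos (by omega)
  have hv0 : v ≠ 0 := by rintro rfl; simp at hv
  let N := B.orthogonal (K ∙ v)
  have hN : finrank K N = 2 := by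
    have := Submodule.finrank_add_eq_of_isCompl
      (LinearMap.BilinForm.isCompl_span_singleton_orthogonal hv)
    rw [finrank_span_singleton hv0, hV] at this
    change 1 + finrank K N = 3 at this
    omega
  have : Invertible (2 : K) := invertibleOfNonzero h2
  have hBN : LinearMap.IsSymm (B.restrict N) := ⟨fun x y => hB.eq x y⟩
  obtain ⟨b, hb⟩ := LinearMap.BilinForm.exists_orthogonal_basis hBN
  let e := b.reindex (finCongr hN)
  have hvN (x : N) : B v x = 0 := x.2 v (Submodule.mem_span_singleton_self v)
  refine ⟨e 0, e 1, ?_, hvN _, hvN _, ?_⟩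
  · rw [Fintype.linearIndependent_iff]
    intro g hg
    simp only [Fin.sum_univ_three, Matrix.cons_val] at hg
    have h0 : g 0 = 0 := by simpa [hvN, hv] using congrArg (B v) hg
    have h12 : g 1 • e 0 + g 2 • e 1 = 0 := by
      apply Subtype.ext
      simpa [h0] using hg
    have := Fintype.linearIndependent_iff.1 e.linearIndependent ![g 1, g 2] (by simpa using h12)
    intro i
    fin_cases i
    exacts [h0, this 0, this 1]
  · have : (B.restrict N) (e 0) (e 1) = 0 := by
      simp only [e, Module.Basis.reindex_apply]
      exact hb (by simp)
    exact this

section Tangent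

variable {K V : Type*} [Field K] [AddCommGroup V] [Module K V] {B : LinearMap.BilinForm K V}

/-- A subspace `W` is tangent to the zero locus of `x ↦ B x x` when it contains exactly one
isotropic line. -/
def IsTangentSubspace (B : LinearMap.BilinForm K V) (W : Submodule K V) : Prop :=
  ∃! L : Submodule K V, L ≤ W ∧ finrank K L = 1 ∧ ∀ w ∈ L, B w w = 0

theorem apply_self_eq_zero_of_mem_span_singleton {x y : V} (hx : B x x = 0) (hy : y ∈ K ∙ x) :
    B y y = 0 := by
  obtain ⟨c, rfl⟩ := Submodule.mem_span_singleton.1 hy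
  simp [hx]

theorem linearIndependent_pair_of_isOrtho {v x : V} (hv : B v v ≠ 0) (hx : x ≠ 0)
    (hvx : B v x = 0) : LinearIndependent K ![v, x] := by
  have hv0 : v ≠ 0 := by rintro rfl; simp at hv
  rw [LinearIndependent.pair_iff' hv0]
  rintro a rfl
  have : a = 0 := by simpa [hv] using hvx
  simp [this] at hx

theorem finrank_span_pair_of_linearIndependent {v x : V} (h : LinearIndependent K ![v, x]) :
    finrank K (Submodule.span K {v, x}) = 2 := by
  rw [← Matrix.range_cons_cons_empty v x ![], finrank_span_eq_card h, Fintype.card_fin]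

theorem isTangentSubspace_span_pair (hB : B.IsSymm) {v x : V} (hv : B v v ≠ 0) (hx : x ≠ 0)
    (hxx : B x x = 0) (hvx : B v x = 0) : IsTangentSubspace B (Submodule.span K {v, x}) := by
  refine ⟨K ∙ x, ⟨Submodule.span_mono (by simp), finrank_span_singleton hx,
    fun w hw => apply_self_eq_zero_of_mem_span_singleton hxx hw⟩, ?_⟩
  rintro L ⟨hLW, hL, hL0⟩
  refine Submodule.eq_of_le_of_finrank_eq (fun w hw => ?_) (by rw [hL, finrank_span_singleton hx])
  obtain ⟨a, b, rfl⟩ := Submodule.mem_span_pair.1 (hLW hw)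
  have h := hL0 _ hw
  have hxv : B x v = 0 := by rw [hB.eq, hvx]
  have ha : a = 0 := by simpa [hxx, hvx, hxv, hv] using h
  subst ha
  simpa using Submodule.smul_mem _ b (Submodule.mem_span_singleton_self x)

theorem IsTangentSubspace.exists_isOrtho (hB : B.IsSymm) {v : V} (hv : B v v ≠ 0)
    {W : Submodule K V} (hvW : v ∈ W) (hW : IsTangentSubspace B W) (h2 : (2 : K) ≠ 0) :
    ∃ x ∈ W, x ≠ 0 ∧ B x x = 0 ∧ B v x = 0 := by
  obtain ⟨L, ⟨hLW, hL, hL0⟩, huniq⟩ := hW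
  obtain ⟨⟨x, hxL⟩, hx0, -⟩ := finrank_eq_one_iff'.1 hL
  replace hx0 : x ≠ 0 := by simpa using hx0
  have hxx := hL0 x hxL
  refine ⟨x, hLW hxL, hx0, hxx, ?_⟩
  by_contra hvx
  -- the reflection of `x` in the line spanned by `v` is another isotropic vector of `W`
  set c := 2 * B v x / B v v with hc
  have hc0 : c ≠ 0 := div_ne_zero (mul_ne_zero h2 hvx) hv
  set y := c • v - x with hy
  have hyy : B y y = 0 := by
    have hxv : B x v = B v x := hB.eq x v
    simp only [hy, map_sub, map_smul, LinearMap.sub_apply, LinearMap.smul_apply, smul_eq_mul, hxx,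
      hxv, hc]
    field_simp
    ring
  have key (hyL : y ∈ L) : False := by
    have : c • v ∈ L := by simpa [hy] using L.add_mem hyL hxL
    exact hv (hL0 v ((L.smul_mem_iff hc0).1 this))
  have hy0 : y ≠ 0 := fun h => key (h ▸ L.zero_mem)
  have hyW : y ∈ W := W.sub_mem (W.smul_mem c hvW) (hLW hxL)
  refine key ?_
  rw [← huniq (K ∙ y) ⟨by simpa using hyW, finrank_span_singleton hy0,
    fun w hw => apply_self_eq_zero_of_mem_span_singleton hyy hw⟩]
  exact Submodule.mem_span_singleton_self y

theorem isTangentSubspace_iff_exists_isOrtho (hB : B.IsSymm) (h2 : (2 : K) ≠ 0) {v : V}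
    (hv : B v v ≠ 0) (W : Submodule K V) :
    (finrank K W = 2 ∧ v ∈ W ∧ IsTangentSubspace B W) ↔
      ∃ x, x ≠ 0 ∧ B x x = 0 ∧ B v x = 0 ∧ W = Submodule.span K {v, x} := by
  constructor
  · rintro ⟨hW, hvW, hWt⟩
    obtain ⟨x, hxW, hx0, hxx, hvx⟩ := hWt.exists_isOrtho hB hv hvW h2
    have : FiniteDimensional K W := FiniteDimensional.of_finrank_pos (by omega)
    refine ⟨x, hx0, hxx, hvx, (Submodule.eq_of_le_of_finrank_eq ?_ ?_).symm⟩
    · rw [Submodule.span_le]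
      rintro _ (rfl | rfl) <;> assumption
    · rw [hW, finrank_span_pair_of_linearIndependent
        (linearIndependent_pair_of_isOrtho hv hx0 hvx)]
  · rintro ⟨x, hx0, hxx, hvx, rfl⟩
    exact ⟨finrank_span_pair_of_linearIndependent (linearIndependent_pair_of_isOrtho hv hx0 hvx),
      Submodule.subset_span (by simp), isTangentSubspace_span_pair hB hv hx0 hxx hvx⟩

theorem exists_eq_smul_add_smul_of_isOrtho (hB : B.IsSymm) (hV : finrank K V = 3) {v u w : V}
    (hli : LinearIndependent K ![v, u, w]) (hv : B v v ≠ 0) (hvu : B v u = 0) (hvw : B v w = 0)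
    (huw : B u w = 0) {x : V} (hvx : B v x = 0) :
    ∃ a b : K, x = a • u + b • w ∧ B x x = a ^ 2 * B u u + b ^ 2 * B w w := by
  have : FiniteDimensional K V := FiniteDimensional.of_finrank_pos (by omega)
  have hspan := hli.span_eq_top_of_card_eq_finrank' (by simp [hV])
  have hx : x ∈ Submodule.span K (Set.range ![v, u, w]) := hspan ▸ Submodule.mem_top
  obtain ⟨g, rfl⟩ := (Submodule.mem_span_range_iff_exists_fun K).1 hx
  have h0 : g 0 = 0 := by simpa [Fin.sum_univ_three, hvu, hvw, hv] using hvx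
  refine ⟨g 1, g 2, by simp [Fin.sum_univ_three, h0], ?_⟩
  have hwu : B w u = 0 := by rw [hB.eq, huw]
  simp [Fin.sum_univ_three, h0, huw, hwu]
  ring

theorem span_pair_smul_right {v x : V} {c : K} (hc : c ≠ 0) :
    Submodule.span K {v, c • x} = Submodule.span K {v, x} := by
  rw [Submodule.span_insert, Submodule.span_insert,
    Submodule.span_singleton_smul_eq hc.isUnit]

theorem ncard_tangent_of_isSquare (hB : B.IsSymm) (h2 : (2 : K) ≠ 0) (hV : finrank K V = 3)
    {v u w : V} (hli : LinearIndependent K ![v, u, w]) (hv : B v v ≠ 0) (hvu : B v u = 0)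
    (hvw : B v w = 0) (huw : B u w = 0) (hu : B u u ≠ 0) (hw : B w w ≠ 0)
    (hsq : IsSquare (-(B u u * B w w))) :
    {W : Submodule K V | finrank K W = 2 ∧ v ∈ W ∧ IsTangentSubspace B W}.ncard = 2 := by
  obtain ⟨s, hs⟩ := hsq
  have hs0 : s ≠ 0 := by
    rintro rfl
    exact mul_ne_zero hu hw (by simpa using hs)
  have hwu : B w u = 0 := by rw [hB.eq, huw]
  have hli' := Fintype.linearIndependent_iff.1 hli
  let x (t : K) : V := t • u + B u u • w
  have hx0 (t : K) : x t ≠ 0 := by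
    intro h
    have := hli' ![0, t, B u u] (by simpa [Fin.sum_univ_three, x] using h) 2
    exact hu (by simpa using this)
  have hvx (t : K) : B v (x t) = 0 := by simp [x, hvu, hvw]
  have hxx {t : K} (ht : t * t = -(B u u * B w w)) : B (x t) (x t) = 0 := by
    simp only [x, map_add, map_smul, LinearMap.add_apply, LinearMap.smul_apply, smul_eq_mul, huw,
      hwu]
    linear_combination B u u * ht
  have hset : {W : Submodule K V | finrank K W = 2 ∧ v ∈ W ∧ IsTangentSubspace B W} =
      {Submodule.span K {v, x s}, Submodule.span K {v, x (-s)}} := by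
    ext W
    rw [Set.mem_ofPred_eq, isTangentSubspace_iff_exists_isOrtho hB h2 hv]
    constructor
    · rintro ⟨y, hy0, hyy, hvy, rfl⟩
      obtain ⟨a, b, rfl, hab⟩ :=
        exists_eq_smul_add_smul_of_isOrtho hB hV hli hv hvu hvw huw hvy
      rw [hyy] at hab
      have hprod : (B u u * a - s * b) * (B u u * a + s * b) = 0 := by
        linear_combination -B u u * hab + b ^ 2 * hs
      have hb : b ≠ 0 := by
        rintro rfl
        have : a = 0 := by simpa [hu] using hab.symm
        simp [this] at hy0
      have key {t : K} (ht : B u u * a = t * b) :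
          Submodule.span K {v, a • u + b • w} = Submodule.span K {v, x t} := by
        rw [← span_pair_smul_right hu, ← span_pair_smul_right (x := x t) hb]
        simp only [x, smul_add, smul_smul, ht, mul_comm b]
      rcases mul_eq_zero.1 hprod with h | h
      · exact .inl (key (by linear_combination h))
      · exact .inr (key (by linear_combination h))
    · rintro (rfl | rfl)
      · exact ⟨x s, hx0 s, hxx hs.symm, hvx s, rfl⟩
      · exact ⟨x (-s), hx0 _, hxx (by rw [neg_mul_neg, hs]), hvx _, rfl⟩
  rw [hset, Set.ncard_pair]
  intro h
  have hmem : x (-s) ∈ Submodule.span K {v, x s} := h ▸ Submodule.subset_span (by simp)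
  obtain ⟨a, b, hab⟩ := Submodule.mem_span_pair.1 hmem
  have hg := hli' ![a, b * s + s, b * B u u - B u u] (by
    simp only [Fin.sum_univ_three, Matrix.cons_val]
    simp only [x] at hab
    linear_combination (norm := module) hab)
  have hb : b = 1 := by
    have := hg 2
    simp only [Matrix.cons_val] at this
    exact mul_right_cancel₀ hu (by linear_combination this)
  have := hg 1
  simp only [Matrix.cons_val, hb] at this
  exact mul_ne_zero h2 hs0 (by linear_combination this)

theorem not_isTangentSubspace_of_not_isSquare (hB : B.IsSymm) (h2 : (2 : K) ≠ 0)
    (hV : finrank K V = 3) {v u w : V} (hli : LinearIndependent K ![v, u, w]) (hv : B v v ≠ 0)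
    (hvu : B v u = 0) (hvw : B v w = 0) (huw : B u w = 0)
    (hsq : ¬ IsSquare (-(B u u * B w w))) {W : Submodule K V} (hvW : v ∈ W) :
    ¬ IsTangentSubspace B W := by
  intro hW
  obtain ⟨y, -, hy0, hyy, hvy⟩ := hW.exists_isOrtho hB hv hvW h2
  obtain ⟨a, b, rfl, hab⟩ := exists_eq_smul_add_smul_of_isOrtho hB hV hli hv hvu hvw huw hvy
  rw [hyy] at hab
  have hb : b ≠ 0 := by
    rintro rfl
    have hu : B u u ≠ 0 := fun h => hsq (by simp [h])
    have : a = 0 := by simpa [hu] using hab.symm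
    simp [this] at hy0
  refine hsq ⟨B u u * a / b, ?_⟩
  field_simp
  linear_combination B u u * hab

end Tangent

theorem exists_det_mul_sq_eq {K : Type*} [Field K] {M : Matrix (Fin 3) (Fin 3) K} (hM : M.IsSymm)
    {v u w : Fin 3 → K} (hli : LinearIndependent K ![v, u, w]) (hvu : v ⬝ᵥ M *ᵥ u = 0)
    (hvw : v ⬝ᵥ M *ᵥ w = 0) (huw : u ⬝ᵥ M *ᵥ w = 0) :
    ∃ d : K, d ≠ 0 ∧
      M.det * d ^ 2 = (v ⬝ᵥ M *ᵥ v) * ((u ⬝ᵥ M *ᵥ u) * (w ⬝ᵥ M *ᵥ w)) := by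
  let P : Matrix (Fin 3) (Fin 3) K := Matrix.of ![v, u, w]
  have hP : IsUnit P.det :=
    (Matrix.isUnit_iff_isUnit_det P).1 (Matrix.linearIndependent_rows_iff_isUnit.1 hli)
  refine ⟨P.det, hP.ne_zero, ?_⟩
  have hswap (x y : Fin 3 → K) : x ⬝ᵥ M *ᵥ y = y ⬝ᵥ M *ᵥ x := by
    rw [Matrix.dotProduct_mulVec, ← Matrix.mulVec_transpose, hM.eq, dotProduct_comm]
  have hdiag : P * M * Pᵀ =
      Matrix.diagonal ![v ⬝ᵥ M *ᵥ v, u ⬝ᵥ M *ᵥ u, w ⬝ᵥ M *ᵥ w] := by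
    have hentry (i j : Fin 3) : (P * M * Pᵀ) i j = ![v, u, w] i ⬝ᵥ M *ᵥ ![v, u, w] j := by
      rw [Matrix.mul_assoc]
      rfl
    ext i j
    rw [hentry]
    fin_cases i <;> fin_cases j <;> simp [hvu, hvw, huw, hswap u v, hswap w v, hswap w u]
  have := congrArg Matrix.det hdiag
  rw [Matrix.det_mul, Matrix.det_mul, Matrix.det_transpose, Matrix.det_diagonal] at this
  simp only [Fin.prod_univ_three, Matrix.cons_val] at this
  linear_combination this

/-- The planar case `n = 3` of Lemma 2.3 (the classical criterion for external/internal
points of an irreducible conic): a point `[v] ∈ ℙ²(F_q)` off the conic `{f = 0}` lies on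
exactly two tangent `F_q`-lines if `(-det M)·f(v)` is a nonzero square, and on no tangent
`F_q`-line if `(-det M)·f(v)` is a non-square.  Lines through `[v]` are the 2-dimensional
subspaces `W ∋ v`, and `W` is tangent when `f` vanishes on exactly one 1-dimensional
subspace of `W`. -/
theorem tangent_lines_external_internal (q : ℕ) (hq : Odd q)
    (F : Type) [Field F] [Fintype F] (hcard : Fintype.card F = q)
    (M : Matrix (Fin 3) (Fin 3) F) (hM : M.IsSymm) (hMdet : IsUnit M.det)
    (v : Fin 3 → F) (hv : v ⬝ᵥ M.mulVec v ≠ 0) :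
    ((IsSquare (-M.det * (v ⬝ᵥ M.mulVec v)) ∧ -M.det * (v ⬝ᵥ M.mulVec v) ≠ 0) →
      {W : Submodule F (Fin 3 → F) | Module.finrank F W = 2 ∧ v ∈ W ∧
        (∃! L : Submodule F (Fin 3 → F), L ≤ W ∧ Module.finrank F L = 1 ∧
          ∀ w ∈ L, w ⬝ᵥ M.mulVec w = 0)}.ncard = 2) ∧
    (¬ IsSquare (-M.det * (v ⬝ᵥ M.mulVec v)) →
      {W : Submodule F (Fin 3 → F) | Module.finrank F W = 2 ∧ v ∈ W ∧
        (∃! L : Submodule F (Fin 3 → F), L ≤ W ∧ Module.finrank F L = 1 ∧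
          ∀ w ∈ L, w ⬝ᵥ M.mulVec w = 0)}.ncard = 0) := by
  have h2 : (2 : F) ≠ 0 := by
    refine Ring.two_ne_zero fun h => ?_
    have := FiniteField.even_card_of_char_two h
    rw [hcard] at this
    exact Nat.not_even_iff_odd.2 hq (Nat.even_iff.2 this)
  let B : LinearMap.BilinForm F (Fin 3 → F) := Matrix.toBilin' M
  have hBapply (x y : Fin 3 → F) : B x y = x ⬝ᵥ M *ᵥ y := Matrix.toBilin'_apply' M x y
  have hB : B.IsSymm := ⟨fun x y => by
    rw [hBapply, hBapply, Matrix.dotProduct_mulVec, ← Matrix.mulVec_transpose, hM.eq,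
      dotProduct_comm]⟩
  have hvB : B v v ≠ 0 := by rwa [hBapply]
  have hV : finrank F (Fin 3 → F) = 3 := by simp
  obtain ⟨u, w, hli, hvu, hvw, huw⟩ := exists_linearIndependent_isOrtho h2 hV hB hvB
  obtain ⟨d, hd, hdet⟩ := exists_det_mul_sq_eq hM hli ((hBapply _ _).symm.trans hvu)
    ((hBapply _ _).symm.trans hvw) ((hBapply _ _).symm.trans huw)
  simp only [← hBapply] at hdet ⊢
  have hne : B u u * B w w ≠ 0 := by
    refine right_ne_zero_of_mul (a := B v v) ?_
    rw [← hdet]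
    exact mul_ne_zero hMdet.ne_zero (pow_ne_zero 2 hd)
  have hiff : IsSquare (-M.det * B v v) ↔ IsSquare (-(B u u * B w w)) := by
    constructor
    · rintro ⟨s, hs⟩
      refine ⟨s * d / B v v, ?_⟩
      field_simp
      linear_combination B v v * hdet + d ^ 2 * hs
    · rintro ⟨s, hs⟩
      refine ⟨s * B v v / d, ?_⟩
      field_simp
      linear_combination -hdet + B v v * hs
  rw [hiff]
  refine ⟨fun h => ncard_tangent_of_isSquare hB h2 hV hli hvB hvu hvw huw
    (left_ne_zero_of_mul hne) (right_ne_zero_of_mul hne) h.1, fun h => ?_⟩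
  rw [Set.ncard_eq_zero, Set.eq_empty_iff_forall_notMem]
  exact fun W hW => not_isTangentSubspace_of_not_isSquare hB h2 hV hli hvB hvu hvw huw h hW.2.1
    hW.2.2
end
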